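/- For m ≥ 1, the lacking polynomial of the complete bipartite graph K_{m,2} with sink v_0 is L_{m,2}(x) = Σ_{k=0}^{m-1} S(m−1,k) x^k, where S(m−1,k) = Σ_{q=0}^{k} Σ_{r=0}^{q} C(m−1,r) for all 0 ≤ k ≤ m−1. -/

import Mathlib

/-!
STATEMENT 6. Model of `K_{m,2}`: left part `{v_0, ..., v_{m-1}}` represented by
`Fin m` (index `0` is the sink `v_0`; the non-sink left vertex `v_{i+1}` is indexed
by `i : Fin (m-1)` and has degree `2`), right part `{v_m, v_{m+1}}` represented by
the two components of a pair (each of degree `m`).  An orientation is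
`O : Fin m → Fin 2 → Bool` (`O i j = true` means directed from left vertex `i`
to right vertex `v_{m+j}`).

A stable configuration is `p : (Fin (m-1) → Fin 2) × (Fin m × Fin m)` where
`p.1 i` is the number of grains on `v_{i+1}`, and `p.2.1`, `p.2.2` are the numbers
of grains on `v_m`, `v_{m+1}`; the types enforce stability.  `p` is compatible
with `O` when `in_O(v) ≥ d(v) - c(v)` for each non-sink vertex, and stochastically
recurrent when compatible with some orientation.  The level of `p` is the sum of
the lacking numbers `d(v) - c(v) - 1`, namely
`(∑ i, (1 - p.1 i)) + (m - 1 - p.2.1) + (m - 1 - p.2.2)`, and the lacking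
polynomial is `L_{m,2}(x) = ∑_{p recurrent} x^{level p}`.

The theorem: `L_{m,2}(x) = ∑_{k=0}^{m-1} S(m-1,k) x^k` where
`S(m-1,k) = ∑_{q=0}^{k} ∑_{r=0}^{q} C(m-1,r)`.
-/

/-- The element of `Fin m` corresponding to the `i`-th non-sink left vertex `v_{i+1}`. -/
def leftIdx {m : ℕ} (i : Fin (m - 1)) : Fin m :=
  ⟨i.val + 1, by have := i.isLt; omega⟩

/-- The number of grains on the non-sink left vertices and their total lacking number sum to the
number of these vertices. -/
theorem sum_lack_add_sum_grains {n : ℕ} (f : Fin n → Fin 2) :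
    ∑ i, (1 - (f i : ℕ)) + ∑ i, (f i : ℕ) = n := by
  rw [← Finset.sum_add_distrib, Finset.sum_congr rfl (g := fun _ => 1)]
  · simp
  · intro i _
    omega

theorem card_filter_grains_eq_one {n : ℕ} (f : Fin n → Fin 2) :
    (Finset.univ.filter fun i => f i = 1).card = ∑ i, (f i : ℕ) := by
  rw [Finset.card_filter]
  refine Finset.sum_congr rfl fun i _ => ?_
  split_ifs with h
  · simp [h]
  · omega

/-- The out-edges of a left vertex that receives `2 - c` in-edges number at most `c`. -/
theorem out_le_of_two_sub_le_in {g : Fin 2 → Bool} {c : ℕ}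
    (h : 2 - c ≤ (Finset.univ.filter fun j : Fin 2 => g j = false).card) :
    (if g 0 = true then 1 else 0) + (if g 1 = true then 1 else 0) ≤ c := by
  rw [Finset.card_filter, Fin.sum_univ_two] at h
  cases h0 : g 0 <;> cases h1 : g 1 <;> simp_all <;> omega

/-- A stable configuration of `K_{n+1,2}` is stochastically recurrent iff its level is at most
`n`. -/
theorem exists_orientation_iff {n : ℕ} (f : Fin n → Fin 2) (a b : Fin (n + 1)) :
    (∃ O : Fin (n + 1) → Fin 2 → Bool,
      (∀ i : Fin n,
        2 - (f i : ℕ) ≤ (Finset.univ.filter fun j : Fin 2 => O i.succ j = false).card) ∧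
      n + 1 - (a : ℕ) ≤ (Finset.univ.filter fun i : Fin (n + 1) => O i 0 = true).card ∧
      n + 1 - (b : ℕ) ≤ (Finset.univ.filter fun i : Fin (n + 1) => O i 1 = true).card) ↔
    ∑ i, (1 - (f i : ℕ)) + (n - (a : ℕ)) + (n - (b : ℕ)) ≤ n := by
  have hs := sum_lack_add_sum_grains f
  constructor
  · rintro ⟨O, hl, h0, h1⟩
    rw [Finset.card_filter, Fin.sum_univ_succ] at h0 h1
    have hsum := Finset.sum_le_sum fun i (_ : i ∈ Finset.univ) => out_le_of_two_sub_le_in (hl i)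
    rw [Finset.sum_add_distrib] at hsum
    have e0 : (if O 0 0 = true then 1 else 0) ≤ 1 := by split_ifs <;> simp
    have e1 : (if O 0 1 = true then 1 else 0) ≤ 1 := by split_ifs <;> simp
    omega
  · intro h
    have hT := card_filter_grains_eq_one f
    set T := Finset.univ.filter fun i => f i = 1 with hTdef
    obtain ⟨U, hUT, hU⟩ := Finset.exists_subset_card_eq (show n - (a : ℕ) ≤ T.card by omega)
    have hd := Finset.card_sdiff_add_card_eq_card hUT
    refine ⟨Fin.cons (fun _ => true)
      fun i j => if j = 0 then decide (i ∈ U) else decide (i ∈ T \ U), ?_, ?_, ?_⟩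
    · intro i
      rw [Finset.card_filter, Fin.sum_univ_two]
      by_cases hi : f i = 1
      · have : i ∈ T := by simp [hTdef, hi]
        by_cases hU : i ∈ U <;> simp [hi, hU, this]
      · have h1 : i ∉ T := by simp [hTdef, hi]
        have h2 : i ∉ U := fun h => h1 (hUT h)
        simp [h1, h2]
    · rw [Finset.card_filter, Fin.sum_univ_succ]
      simp only [Fin.cons_zero, Fin.cons_succ, if_true, decide_eq_true_eq]
      rw [← Finset.card_filter, Finset.filter_mem_eq_inter, Finset.univ_inter]
      omega
    · rw [Finset.card_filter, Fin.sum_univ_succ]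
      simp only [Fin.cons_zero, Fin.cons_succ, if_true, one_ne_zero, if_false, decide_eq_true_eq]
      rw [← Finset.card_filter, Finset.filter_mem_eq_inter, Finset.univ_inter]
      omega

/-- Grouping the configurations on `n` left vertices by their total lacking number. -/
theorem sum_apply_lack {M : Type*} [AddCommMonoid M] (n : ℕ) (g : ℕ → M) :
    ∑ f : Fin n → Fin 2, g (∑ i, (1 - (f i : ℕ))) =
      ∑ r ∈ Finset.range (n + 1), n.choose r • g r := by
  have h := Finset.sum_powerset_apply_card (f := g) (x := (Finset.univ : Finset (Fin n)))
  rw [Finset.card_fin, Finset.powerset_univ] at h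
  rw [← h]
  refine Finset.sum_bij' (fun f _ => Finset.univ.filter fun i => f i = 0)
    (fun T _ i => if i ∈ T then 0 else 1) (by simp) (by simp) ?_ ?_ ?_
  · intro f _
    funext i
    by_cases hi : f i = 0
    · simp [hi]
    · simp only [Finset.mem_filter, Finset.mem_univ, true_and, hi, if_false]
      omega
  · intro T _
    ext i
    simp
  · intro f _
    rw [Finset.card_filter]
    congr 1
    refine Finset.sum_congr rfl fun i _ => ?_
    split_ifs with h
    · simp [h]
    · omega

/-- Reindexing by lacking numbers instead of numbers of grains. -/
theorem sum_fin_lack {M : Type*} [AddCommMonoid M] (n : ℕ) (g : ℕ → M) :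
    ∑ a : Fin (n + 1), g (n - (a : ℕ)) = ∑ a ∈ Finset.range (n + 1), g a := by
  rw [Fin.sum_univ_eq_sum_range (fun a => g (n - a))]
  simpa using Finset.sum_range_reflect g (n + 1)

theorem sum_choose_smul_eq {R : Type*} [Semiring R] (n : ℕ) (x : R) :
    ∑ r ∈ Finset.range (n + 1), n.choose r •
        ∑ a ∈ Finset.range (n + 1), ∑ b ∈ Finset.range (n + 1),
          (if r + a + b ≤ n then x ^ (r + a + b) else 0) =
      ∑ k ∈ Finset.range (n + 1), ∑ q ∈ Finset.range (k + 1), ∑ r ∈ Finset.range (q + 1),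
        n.choose r • x ^ k := by
  simp only [Finset.smul_sum, smul_ite, smul_zero]
  simp only [← Finset.sum_filter]
  simp only [Finset.sum_sigma']
  refine Finset.sum_bij' (fun t _ => ⟨t.1 + t.2.1 + t.2.2, t.1 + t.2.1, t.1⟩)
    (fun t _ => ⟨t.2.2, t.2.1 - t.2.2, t.1 - t.2.1⟩) ?_ ?_ ?_ ?_ ?_
  · simp only [Finset.mem_sigma, Finset.mem_filter, Finset.mem_range]
    omega
  · simp only [Finset.mem_sigma, Finset.mem_filter, Finset.mem_range]
    omega
  · rintro ⟨r, a, b⟩ _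
    simp
  · rintro ⟨k, q, r⟩ ht
    simp only [Finset.mem_sigma, Finset.mem_range] at ht
    have h1 : r + (q - r) = q := by omega
    have h2 : q + (k - q) = k := by omega
    simp [h1, h2]
  · simp

theorem lacking_polynomial_Km2 (m : ℕ) (hm : 1 ≤ m) :
    ∑ p ∈ (Finset.univ : Finset ((Fin (m - 1) → Fin 2) × (Fin m × Fin m))).filter
        (fun p => ∃ O : Fin m → Fin 2 → Bool,
          (∀ i : Fin (m - 1),
            2 - (p.1 i : ℕ) ≤
              (Finset.univ.filter fun j : Fin 2 => O (leftIdx i) j = false).card) ∧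
          m - (p.2.1 : ℕ) ≤ (Finset.univ.filter fun i : Fin m => O i 0 = true).card ∧
          m - (p.2.2 : ℕ) ≤ (Finset.univ.filter fun i : Fin m => O i 1 = true).card),
      (Polynomial.X : Polynomial ℤ) ^
        ((∑ i : Fin (m - 1), (1 - (p.1 i : ℕ))) +
          (m - 1 - (p.2.1 : ℕ)) + (m - 1 - (p.2.2 : ℕ)))
    = ∑ k ∈ Finset.range m,
        Polynomial.C (∑ q ∈ Finset.range (k + 1), ∑ r ∈ Finset.range (q + 1),
            ((m - 1).choose r : ℤ)) * Polynomial.X ^ k := by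
  obtain ⟨n, rfl⟩ := Nat.exists_eq_add_of_le' hm
  simp only [Nat.add_sub_cancel]
  have hrec := fun p : (Fin n → Fin 2) × (Fin (n + 1) × Fin (n + 1)) =>
    exists_orientation_iff p.1 p.2.1 p.2.2
  rw [Finset.sum_filter]
  set g : ℕ → ℕ → ℕ → Polynomial ℤ := fun r a b =>
    if r + a + b ≤ n then Polynomial.X ^ (r + a + b) else 0
  calc _ = ∑ p : (Fin n → Fin 2) × (Fin (n + 1) × Fin (n + 1)),
        g (∑ i, (1 - (p.1 i : ℕ))) (n - p.2.1) (n - p.2.2) :=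
        Finset.sum_congr rfl fun p _ => if_congr (hrec p) rfl rfl
    _ = ∑ f : Fin n → Fin 2, ∑ a : Fin (n + 1), ∑ b : Fin (n + 1),
        g (∑ i, (1 - (f i : ℕ))) (n - a) (n - b) := by
      simp only [Fintype.sum_prod_type]
    _ = ∑ r ∈ Finset.range (n + 1), n.choose r •
        ∑ a ∈ Finset.range (n + 1), ∑ b ∈ Finset.range (n + 1), g r a b := by
      simp only [fun r a => sum_fin_lack n (g r a)]
      simp only [fun r => sum_fin_lack n fun a => ∑ b ∈ Finset.range (n + 1), g r a b]
      exact sum_apply_lack n fun r =>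
        ∑ a ∈ Finset.range (n + 1), ∑ b ∈ Finset.range (n + 1), g r a b
    _ = _ := by
      rw [sum_choose_smul_eq]
      simp [Finset.sum_mul]
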